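/- If f : ℝ^d × Ξ → ℝ is B(ℝ^d) ⊗ T-measurable and f(·,s) is locally Lipschitz continuous for every s ∈ Ξ, then the complement of Δ_f = {(x,s) : f(·,s) is differentiable at x} is (λ ⊗ μ)-negligible, where λ is Lebesgue measure on ℝ^d. -/

import Mathlib

open MeasureTheory Filter Set

/-- A map into `C(X, Y)` whose evaluations at all points are measurable is Borel measurable for the
compact-open topology. -/
theorem measurable_continuousMap_of_eval {Ω X Y : Type*} [MeasurableSpace Ω]
    [TopologicalSpace X] [SecondCountableTopology X] [LocallyCompactSpace X]
    [PseudoMetricSpace Y] [SecondCountableTopology Y] [MeasurableSpace Y] [BorelSpace Y]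
    [MeasurableSpace C(X, Y)] [BorelSpace C(X, Y)]
    {g : Ω → C(X, Y)} (hg : ∀ x, Measurable fun ω => g ω x) : Measurable g := by
  rw [BorelSpace.measurable_eq (α := C(X, Y)),
    borel_eq_generateFrom_of_subbasis ContinuousMap.compactOpen_eq]
  refine measurable_generateFrom ?_
  rintro _ ⟨K, hK, U, hU, rfl⟩
  replace hK : IsCompact K := hK
  replace hU : IsOpen U := hU
  obtain ⟨D, hDc, hDd⟩ := TopologicalSpace.exists_countable_dense K
  have hclosed (n : ℕ) : IsClosed {y : Y | ((n : ENNReal))⁻¹ ≤ Metric.infEDist y Uᶜ} :=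
    isClosed_le continuous_const Metric.continuous_infEDist
  have key : g ⁻¹' {f : C(X, Y) | MapsTo f K U} =
      ⋃ n : ℕ, ⋂ x ∈ D, {ω | ((n : ENNReal))⁻¹ ≤ Metric.infEDist (g ω x) Uᶜ} := by
    ext ω
    simp only [mem_preimage, mem_ofPred_eq, mem_iUnion, mem_iInter]
    constructor
    · intro h
      obtain ⟨r, hr, hlt⟩ := Metric.exists_pos_forall_lt_edist
        (hK.image (g ω).continuous) hU.isClosed_compl
        (disjoint_compl_right_iff_subset.2 h.image_subset)
      obtain ⟨n, hn⟩ := ENNReal.exists_inv_nat_lt (ENNReal.coe_pos.2 hr).ne'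
      refine ⟨n, fun x _ => hn.le.trans ?_⟩
      exact Metric.le_infEDist.2 fun y hy => (hlt _ (mem_image_of_mem _ x.2) y hy).le
    · rintro ⟨n, hn⟩ x hx
      have hall : closure D ⊆
          (fun x : K => g ω x) ⁻¹' {y : Y | ((n : ENNReal))⁻¹ ≤ Metric.infEDist y Uᶜ} :=
        closure_minimal hn ((hclosed n).preimage ((g ω).continuous.comp continuous_subtype_val))
      have hle : ((n : ENNReal))⁻¹ ≤ Metric.infEDist (g ω x) Uᶜ := hall (hDd ⟨x, hx⟩)
      by_contra hxU
      rw [Metric.infEDist_zero_of_mem (show g ω x ∈ Uᶜ from hxU)] at hle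
      exact absurd hle (by simp)
  rw [key]
  exact .iUnion fun n => .biInter hDc fun x _ => hg x (hclosed n).measurableSet

/-- The set of pairs `(x, ω)` at which a Carathéodory function is differentiable in its first
variable is measurable. -/
theorem measurableSet_differentiableAt_of_measurable_eval {Ω E F : Type*} [MeasurableSpace Ω]
    [NormedAddCommGroup E] [NormedSpace ℝ E] [FiniteDimensional ℝ E] [MeasurableSpace E]
    [BorelSpace E] [NormedAddCommGroup F] [NormedSpace ℝ F] [CompleteSpace F]
    [SecondCountableTopology F] [MeasurableSpace F] [BorelSpace F] {f : E × Ω → F}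
    (hmeas : ∀ x, Measurable fun ω => f (x, ω)) (hcont : ∀ ω, Continuous fun x => f (x, ω)) :
    MeasurableSet {p : E × Ω | DifferentiableAt ℝ (fun x => f (x, p.2)) p.1} := by
  have : ProperSpace E := FiniteDimensional.proper_real E
  let : MeasurableSpace C(E, F) := borel _
  have : BorelSpace C(E, F) := ⟨rfl⟩
  let g : Ω → C(E, F) := fun ω => ⟨fun x => f (x, ω), hcont ω⟩
  have hg : Measurable g := measurable_continuousMap_of_eval hmeas
  have hD : MeasurableSet {q : C(E, F) × E | DifferentiableAt ℝ (q.1 : E → F) q.2} :=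
    measurableSet_of_differentiableAt_with_param ℝ
      (f := fun (h : C(E, F)) x => h x) ContinuousEval.continuous_eval
  exact ((hg.comp measurable_snd).prodMk measurable_fst) hD

/-- **Rademacher's theorem** for locally Lipschitz functions. -/
theorem LocallyLipschitz.ae_differentiableAt {E F : Type*}
    [NormedAddCommGroup E] [NormedSpace ℝ E] [FiniteDimensional ℝ E] [MeasurableSpace E]
    [BorelSpace E] [NormedAddCommGroup F] [NormedSpace ℝ F] [FiniteDimensional ℝ F]
    {ν : Measure E} [ν.IsAddHaarMeasure] {f : E → F} (hf : LocallyLipschitz f) :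
    ∀ᵐ x ∂ν, DifferentiableAt ℝ f x := by
  have : ProperSpace E := FiniteDimensional.proper_real E
  refine measure_null_of_locally_null _ fun x _ => ?_
  obtain ⟨C, t, ht, hC⟩ := hf x
  refine ⟨_, inter_mem_nhdsWithin _ (interior_mem_nhds.2 ht), ?_⟩
  refine measure_mono_null ?_ (hC.ae_differentiableWithinAt_of_mem (μ := ν))
  rintro y ⟨hy, hyt⟩ h
  exact hy ((h (interior_subset hyt)).differentiableAt (mem_interior_iff_mem_nhds.1 hyt))

/-- If `f` is jointly measurable and `f(·,s)` is locally Lipschitz for every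
`s`, then the complement of `Δ_f = {(x,s) : f(·,s) differentiable at x}` is
`λ ⊗ μ`-negligible. -/
theorem stmt2 {d : ℕ} {Ξ : Type*} [MeasurableSpace Ξ]
    (μ : Measure Ξ) [IsProbabilityMeasure μ]
    (f : EuclideanSpace ℝ (Fin d) × Ξ → ℝ)
    (hf : Measurable f)
    (hlip : ∀ s : Ξ, LocallyLipschitz (fun x => f (x, s))) :
    ((volume : Measure (EuclideanSpace ℝ (Fin d))).prod μ)
      {p : EuclideanSpace ℝ (Fin d) × Ξ |
        ¬ DifferentiableAt ℝ (fun x => f (x, p.2)) p.1} = 0 := by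
  have hD := measurableSet_differentiableAt_of_measurable_eval (f := f)
    (fun x => hf.comp measurable_prodMk_left) fun s => (hlip s).continuous
  rw [← compl_ofPred, Measure.prod_apply_symm hD.compl]
  exact lintegral_eq_zero_of_ae_eq_zero (.of_forall fun s => (hlip s).ae_differentiableAt)
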